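/- Let U ⊂ ℝ⁴ be an open neighborhood of C₊ that is invariant under multiplication by positive scalars, and let V: U → ℂ⁴ be smooth with V(λl) = λ^{-1} V(l) for all λ > 0 and l ∈ U, and with l·V(l) = 0 (Minkowski product) for all l ∈ U. Then ∫_{S²} (∂·V)(1, n̂) dΩ(n̂) = 0, where ∂·V = Σ_{a=0}^{3} ∂V^a/∂l^a is the coordinate divergence. -/

import Mathlib

/-!
Statement 15: for a smooth vector field `V` on a scale-invariant neighborhood of the
forward light cone, homogeneous of degree `−1` and Minkowski-orthogonal to `l`,
the integral of the coordinate divergence over the null directions vanishes: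
`∫_{S²} (∂·V)(1,n̂) dΩ(n̂) = 0`.
-/

open Real MeasureTheory

noncomputable section

/-- Minkowski inner product on ℝ⁴ with signature `(+,−,−,−)`. -/
def mink4 (x y : Fin 4 → ℝ) : ℝ := x 0 * y 0 - x 1 * y 1 - x 2 * y 2 - x 3 * y 3

/-- Minkowski pairing of a real vector with a complex vector. -/
def minkC (x : Fin 4 → ℝ) (v : Fin 4 → ℂ) : ℂ :=
  (x 0 : ℂ) * v 0 - (x 1 : ℂ) * v 1 - (x 2 : ℂ) * v 2 - (x 3 : ℂ) * v 3

/-- The null vector `(1, n̂)` associated with a unit vector `n̂ ∈ ℝ³`. -/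
def toCone (n : EuclideanSpace ℝ (Fin 3)) : Fin 4 → ℝ := ![1, n 0, n 1, n 2]

/-- The point of the forward light cone lying over `x ∈ ℝ³`. -/
def coneLift (x : EuclideanSpace ℝ (Fin 3)) : Fin 4 → ℝ := ![‖x‖, x 0, x 1, x 2]

/-- The coordinate divergence of a vector field on `ℝ⁴`. -/
def divergence4 (V : (Fin 4 → ℝ) → (Fin 4 → ℂ)) (l : Fin 4 → ℝ) : ℂ :=
  ∑ a : Fin 4, fderiv ℝ (fun y => V y a) l (Pi.single a 1)

/-- The `i`-th component of the projection to the sphere directions of the restriction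
of `V` to the light cone. -/
def tangentField (V : (Fin 4 → ℝ) → (Fin 4 → ℂ)) (i : Fin 3)
    (x : EuclideanSpace ℝ (Fin 3)) : ℂ :=
  V (coneLift x) i.succ - (x i : ℂ) * ((‖x‖⁻¹ : ℝ) : ℂ) * V (coneLift x) 0

lemma norm_sq_eq_three (x : EuclideanSpace ℝ (Fin 3)) :
    ‖x‖ ^ 2 = x 0 ^ 2 + x 1 ^ 2 + x 2 ^ 2 := by
  simp [EuclideanSpace.norm_sq_eq, Fin.sum_univ_three]

lemma coneLift_smul {r : ℝ} (hr : 0 ≤ r) (x : EuclideanSpace ℝ (Fin 3)) :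
    coneLift (r • x) = r • coneLift x := by
  ext a
  fin_cases a <;> simp [coneLift, norm_smul, abs_of_nonneg hr]

lemma coneLift_of_norm_eq_one {x : EuclideanSpace ℝ (Fin 3)} (hx : ‖x‖ = 1) :
    coneLift x = toCone x := by
  simp [coneLift, toCone, hx]

lemma coneLift_mem_cone {x : EuclideanSpace ℝ (Fin 3)} (hx : x ≠ 0) :
    coneLift x ∈ {l : Fin 4 → ℝ | mink4 l l = 0 ∧ 0 < l 0} := by
  refine ⟨?_, by simpa [coneLift] using hx⟩
  have h := norm_sq_eq_three x
  simp only [mink4, coneLift, Matrix.cons_val]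
  linarith

lemma contDiffAt_coneLift {x : EuclideanSpace ℝ (Fin 3)} (hx : x ≠ 0) :
    ContDiffAt ℝ 1 coneLift x := by
  rw [contDiffAt_pi]
  intro a
  fin_cases a
  · exact contDiffAt_norm ℝ hx
  all_goals
    simp only [coneLift]
    exact contDiffAt_piLp_apply 2

lemma hasDerivAt_norm_line {x : EuclideanSpace ℝ (Fin 3)} (hx : x ≠ 0) (i : Fin 3) :
    HasDerivAt (fun t : ℝ => ‖x + t • EuclideanSpace.single i (1 : ℝ)‖) (x i / ‖x‖) 0 := by
  have hline : HasDerivAt (fun t : ℝ => x + t • EuclideanSpace.single i (1 : ℝ))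
      (EuclideanSpace.single i (1 : ℝ)) 0 := by
    simpa using ((hasDerivAt_id (0 : ℝ)).smul_const
      (EuclideanSpace.single i (1 : ℝ))).const_add x
  have h := hline.norm_sq.sqrt (by simpa using hx)
  simp only [Real.sqrt_sq (norm_nonneg _)] at h
  convert h using 1
  simp [EuclideanSpace.inner_single_right]
  field_simp

lemma hasDerivAt_coord_line (x : EuclideanSpace ℝ (Fin 3)) (i j : Fin 3) :
    HasDerivAt (fun t : ℝ => (x + t • EuclideanSpace.single i (1 : ℝ)) j)
      (if j = i then 1 else 0) 0 := by
  simpa [Pi.single_apply] using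
    ((hasDerivAt_id (0 : ℝ)).mul_const (if j = i then (1 : ℝ) else 0)).const_add (x j)

lemma hasDerivAt_comp_coneLift_line {F : (Fin 4 → ℝ) → ℂ} {x : EuclideanSpace ℝ (Fin 3)}
    (hx : x ≠ 0) (hF : DifferentiableAt ℝ F (coneLift x)) (i : Fin 3) :
    HasDerivAt (fun t : ℝ => F (coneLift (x + t • EuclideanSpace.single i (1 : ℝ))))
      (((x i / ‖x‖ : ℝ) : ℂ) * fderiv ℝ F (coneLift x) (Pi.single 0 1)
        + fderiv ℝ F (coneLift x) (Pi.single i.succ 1)) 0 := by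
  have hlift : HasDerivAt
      (fun t : ℝ => coneLift (x + t • EuclideanSpace.single i (1 : ℝ)))
      ((x i / ‖x‖) • Pi.single 0 1 + Pi.single i.succ 1) 0 := by
    rw [hasDerivAt_pi]
    intro a
    refine Fin.cases ?_ (fun j => ?_) a
    · simpa [coneLift] using hasDerivAt_norm_line hx i
    · have h := hasDerivAt_coord_line x i j
      have hcoord (y : EuclideanSpace ℝ (Fin 3)) : coneLift y j.succ = y j := by
        fin_cases j <;> rfl
      simpa only [hcoord, Pi.add_apply, Pi.smul_apply, Pi.single_apply, Fin.succ_ne_zero,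
        if_false, smul_zero, zero_add, Fin.succ_inj] using h
  have hF' : HasFDerivAt F (fderiv ℝ F (coneLift x))
      (coneLift (x + (0 : ℝ) • EuclideanSpace.single i (1 : ℝ))) := by
    simpa using hF.hasFDerivAt
  have h := hF'.comp_hasDerivAt (0 : ℝ) hlift
  rwa [map_add, map_smul, Complex.real_smul] at h

lemma fderiv_apply_self_of_homogeneous {F : (Fin 4 → ℝ) → ℂ} {l : Fin 4 → ℝ}
    (hF : DifferentiableAt ℝ F l)
    (hhom : ∀ lam : ℝ, 0 < lam → F (lam • l) = (lam : ℂ)⁻¹ * F l) :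
    fderiv ℝ F l l = - F l := by
  have hline : HasDerivAt (fun t : ℝ => t • l) l 1 := by
    simpa using (hasDerivAt_id (1 : ℝ)).smul_const l
  have hF' : HasFDerivAt F (fderiv ℝ F l) ((1 : ℝ) • l) := by simpa using hF.hasFDerivAt
  have h := hF'.comp_hasDerivAt (1 : ℝ) hline
  have hinv : HasDerivAt (fun t : ℝ => ((t⁻¹ : ℝ) : ℂ) * F l) (-F l) 1 := by
    simpa using ((hasDerivAt_inv (one_ne_zero (α := ℝ))).ofReal_comp).mul_const (F l)
  refine h.unique (hinv.congr_of_eventuallyEq ?_)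
  filter_upwards [lt_mem_nhds (zero_lt_one (α := ℝ))] with t ht
  simp [hhom t ht]

lemma fderiv_smul_of_homogeneous {U : Set (Fin 4 → ℝ)} {F : (Fin 4 → ℝ) → ℂ}
    (hUopen : IsOpen U)
    (hhom : ∀ lam : ℝ, 0 < lam → ∀ l ∈ U, F (lam • l) = (lam : ℂ)⁻¹ * F l)
    {lam : ℝ} (hlam : 0 < lam) {l : Fin 4 → ℝ} (hl : l ∈ U) (v : Fin 4 → ℝ) :
    (lam : ℂ) ^ 2 * fderiv ℝ F (lam • l) v = fderiv ℝ F l v := by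
  have hev : (fun y => F (lam • y)) =ᶠ[nhds l] fun y => (lam⁻¹ : ℝ) • F y := by
    filter_upwards [hUopen.mem_nhds hl] with y hy
    simp [hhom lam hlam y hy]
  have h := (fderiv_comp_smul lam).symm.trans (hev.fderiv_eq (𝕜 := ℝ))
  rw [show (fun y => (lam⁻¹ : ℝ) • F y) = (lam⁻¹ : ℝ) • F from rfl,
    fderiv_const_smul_field, Pi.smul_apply] at h
  have h' := congrArg (fun A => A v) h
  simp only [smul_apply, Complex.real_smul, Complex.ofReal_inv] at h'
  have h0 : (lam : ℂ) ≠ 0 := by exact_mod_cast hlam.ne'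
  rw [sq, mul_assoc, h', mul_inv_cancel_left₀ h0]

/-- Differentiating the orthogonality relation in the time direction. -/
lemma deriv_time_orthogonal {U : Set (Fin 4 → ℝ)} {V : (Fin 4 → ℝ) → (Fin 4 → ℂ)}
    (hUopen : IsOpen U) (hV : DifferentiableOn ℝ V U)
    (horth : ∀ l ∈ U, minkC l (V l) = 0) {l : Fin 4 → ℝ} (hl : l ∈ U) :
    V l 0 + (l 0 : ℂ) * fderiv ℝ (fun y => V y 0) l (Pi.single 0 1)
      - (l 1 : ℂ) * fderiv ℝ (fun y => V y 1) l (Pi.single 0 1)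
      - (l 2 : ℂ) * fderiv ℝ (fun y => V y 2) l (Pi.single 0 1)
      - (l 3 : ℂ) * fderiv ℝ (fun y => V y 3) l (Pi.single 0 1) = 0 := by
  have hline : HasDerivAt (fun t : ℝ => l + t • (Pi.single 0 1 : Fin 4 → ℝ))
      (Pi.single 0 1) 0 := by
    simpa using ((hasDerivAt_id (0 : ℝ)).smul_const
      (Pi.single 0 1 : Fin 4 → ℝ)).const_add l
  have hcoord (a : Fin 4) := ((hasDerivAt_pi.1 hline) a).ofReal_comp
  have hcomp (a : Fin 4) : HasDerivAt (fun t : ℝ => V (l + t • Pi.single 0 1) a)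
      (fderiv ℝ (fun y => V y a) l (Pi.single 0 1)) 0 := by
    have hd := differentiableAt_pi.1 (hV.differentiableAt (hUopen.mem_nhds hl)) a
    have hd' : HasFDerivAt (fun y => V y a) (fderiv ℝ (fun y => V y a) l)
        (l + (0 : ℝ) • (Pi.single 0 1 : Fin 4 → ℝ)) := by simpa using hd.hasFDerivAt
    exact hd'.comp_hasDerivAt (0 : ℝ) hline
  have h := ((((hcoord 0).mul (hcomp 0)).sub ((hcoord 1).mul (hcomp 1))).sub
    ((hcoord 2).mul (hcomp 2))).sub ((hcoord 3).mul (hcomp 3))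
  have hzero : HasDerivAt (fun _ : ℝ => (0 : ℂ)) 0 0 := hasDerivAt_const _ _
  have hmem : ∀ᶠ t : ℝ in nhds 0, l + t • (Pi.single 0 1 : Fin 4 → ℝ) ∈ U :=
    hline.continuousAt.eventually (by simpa using hUopen.mem_nhds hl)
  have := h.unique (hzero.congr_of_eventuallyEq
    (by filter_upwards [hmem] with t ht using horth _ ht))
  simpa using this

/-- The radially cut off tangential field. -/
def cutoffField (η : ℝ → ℝ) (V : (Fin 4 → ℝ) → (Fin 4 → ℂ)) (i : Fin 3)
    (x : EuclideanSpace ℝ (Fin 3)) : ℂ :=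
  (η ‖x‖ : ℂ) * tangentField V i x

section Cutoff

variable {U : Set (Fin 4 → ℝ)} {V : (Fin 4 → ℝ) → (Fin 4 → ℂ)} {η : ℝ → ℝ}

lemma hasDerivAt_cutoffField_line {x : EuclideanSpace ℝ (Fin 3)} (hx : x ≠ 0)
    (hη : DifferentiableAt ℝ η ‖x‖) (hV : DifferentiableAt ℝ V (coneLift x)) (i : Fin 3) :
    HasDerivAt (fun t : ℝ => cutoffField η V i (x + t • EuclideanSpace.single i (1 : ℝ)))
      (deriv η ‖x‖ * (x i / ‖x‖) * tangentField V i x + η ‖x‖ *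
        (x i / ‖x‖ * fderiv ℝ (fun y => V y i.succ) (coneLift x) (Pi.single 0 1)
          + fderiv ℝ (fun y => V y i.succ) (coneLift x) (Pi.single i.succ 1)
          - ((1 / ‖x‖ - x i ^ 2 / ‖x‖ ^ 3) * V (coneLift x) 0
            + x i / ‖x‖ * (x i / ‖x‖ * fderiv ℝ (fun y => V y 0) (coneLift x) (Pi.single 0 1)
              + fderiv ℝ (fun y => V y 0) (coneLift x) (Pi.single i.succ 1))))) 0 := by
  have hr : (‖x‖ : ℂ) ≠ 0 := by simpa using hx
  have hnorm := hasDerivAt_norm_line hx i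
  have hcomp (a : Fin 4) :=
    hasDerivAt_comp_coneLift_line hx (differentiableAt_pi.1 hV a) i
  have hη' : HasDerivAt η (deriv η ‖x‖)
      ‖x + (0 : ℝ) • EuclideanSpace.single i (1 : ℝ)‖ := by simpa using hη.hasDerivAt
  have hcut := (hη'.comp (0 : ℝ) hnorm).ofReal_comp
  have hcoord := (hasDerivAt_coord_line x i i).ofReal_comp
  have hinv := (hnorm.fun_inv (by simpa using hx)).ofReal_comp
  have h := hcut.mul ((hcomp i.succ).sub ((hcoord.mul hinv).mul (hcomp 0)))
  refine h.congr_deriv ?_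
  simp only [Function.comp_apply, zero_smul, add_zero, if_true, Complex.ofReal_one,
    Complex.ofReal_mul, Complex.ofReal_div, Complex.ofReal_neg, Complex.ofReal_pow,
    Complex.ofReal_inv, tangentField, Pi.sub_apply, Pi.mul_apply]
  field_simp
  ring

lemma contDiffAt_tangentField {x : EuclideanSpace ℝ (Fin 3)} (hx : x ≠ 0)
    (hV : ContDiffAt ℝ 1 V (coneLift x)) (i : Fin 3) :
    ContDiffAt ℝ 1 (tangentField V i) x := by
  have hcomp (a : Fin 4) : ContDiffAt ℝ 1 (fun y => V (coneLift y) a) x :=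
    contDiffAt_pi.1 (hV.comp x (contDiffAt_coneLift hx)) a
  have hcoord : ContDiffAt ℝ 1 (fun y : EuclideanSpace ℝ (Fin 3) => (y i : ℂ)) x :=
    Complex.ofRealCLM.contDiff.contDiffAt.comp x (contDiffAt_piLp_apply 2)
  have hinv : ContDiffAt ℝ 1
      (fun y : EuclideanSpace ℝ (Fin 3) => ((‖y‖⁻¹ : ℝ) : ℂ)) x :=
    Complex.ofRealCLM.contDiff.contDiffAt.comp x
      ((contDiffAt_norm ℝ hx).inv (norm_ne_zero_iff.2 hx))
  exact (hcomp i.succ).sub ((hcoord.mul hinv).mul (hcomp 0))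

lemma cutoffField_eventuallyEq_zero (hη0 : ∀ r ≤ 1, η r = 0) (i : Fin 3) :
    cutoffField η V i =ᶠ[nhds 0] fun _ => 0 := by
  filter_upwards [Metric.ball_mem_nhds (0 : EuclideanSpace ℝ (Fin 3)) one_pos] with y hy
  simp [cutoffField, hη0 ‖y‖ (mem_ball_zero_iff.1 hy).le]

lemma contDiff_cutoffField (hη : ContDiff ℝ 1 η) (hη0 : ∀ r ≤ 1, η r = 0)
    (hV : ∀ x ≠ 0, ContDiffAt ℝ 1 V (coneLift x)) (i : Fin 3) :
    ContDiff ℝ 1 (cutoffField η V i) := by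
  rw [contDiff_iff_contDiffAt]
  intro x
  by_cases hx : x = 0
  · subst hx
    exact contDiffAt_const.congr_of_eventuallyEq (cutoffField_eventuallyEq_zero hη0 i)
  · have hcut : ContDiffAt ℝ 1
        (fun y : EuclideanSpace ℝ (Fin 3) => ((η ‖y‖ : ℝ) : ℂ)) x :=
      Complex.ofRealCLM.contDiff.contDiffAt.comp x
        (hη.contDiffAt.comp x (contDiffAt_norm ℝ hx))
    exact hcut.mul (contDiffAt_tangentField hx (hV x hx) i)

lemma hasCompactSupport_cutoffField (hη3 : ∀ r, 3 ≤ r → η r = 0) (i : Fin 3) :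
    HasCompactSupport (cutoffField η V i) := by
  refine HasCompactSupport.intro (isCompact_closedBall 0 3) fun x hx => ?_
  rw [mem_closedBall_zero_iff, not_le] at hx
  simp [cutoffField, hη3 _ hx.le]

lemma sum_fderiv_cutoffField (hUopen : IsOpen U)
    (hUcone : {l : Fin 4 → ℝ | mink4 l l = 0 ∧ 0 < l 0} ⊆ U)
    (hV : DifferentiableOn ℝ V U)
    (hhom : ∀ lam : ℝ, 0 < lam → ∀ l ∈ U, V (lam • l) = ((lam : ℂ)⁻¹) • V l)
    (horth : ∀ l ∈ U, minkC l (V l) = 0)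
    (hη : Differentiable ℝ η) (hη0 : ∀ r ≤ 1, η r = 0)
    (hdiff : ∀ i, Differentiable ℝ (cutoffField η V i)) (x : EuclideanSpace ℝ (Fin 3)) :
    ∑ i : Fin 3, fderiv ℝ (cutoffField η V i) x (EuclideanSpace.single i 1)
      = η ‖x‖ * divergence4 V (coneLift x) := by
  by_cases hx : x = 0
  · subst hx
    simp [(cutoffField_eventuallyEq_zero (V := V) hη0 _).fderiv_eq, hη0]
  have hl := hUcone (coneLift_mem_cone hx)
  have hVx := hV.differentiableAt (hUopen.mem_nhds hl)
  have hr : (‖x‖ : ℂ) ≠ 0 := by simpa using hx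
  have hsq : (‖x‖ : ℂ) ^ 2 = (x 0 : ℂ) ^ 2 + (x 1 : ℂ) ^ 2 + (x 2 : ℂ) ^ 2 := by
    exact_mod_cast norm_sq_eq_three x
  have hderiv (i : Fin 3) := ((hdiff i x).lineDeriv_eq_fderiv).symm.trans
    (hasDerivAt_cutoffField_line hx (hη _) hVx i).deriv
  have heuler := fderiv_apply_self_of_homogeneous (differentiableAt_pi.1 hVx 0)
    (fun lam hlam => by simp [hhom lam hlam _ hl])
  have hdec : coneLift x = ‖x‖ • Pi.single 0 1 + x 0 • Pi.single 1 1
      + x 1 • Pi.single 2 1 + x 2 • Pi.single 3 1 := by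
    ext a
    fin_cases a <;> simp [coneLift]
  have htime := deriv_time_orthogonal hUopen hV horth hl
  have horthx := horth _ hl
  have heuler' : (‖x‖ : ℂ) * fderiv ℝ (fun y => V y 0) (coneLift x) (Pi.single 0 1)
      + x 0 * fderiv ℝ (fun y => V y 0) (coneLift x) (Pi.single 1 1)
      + x 1 * fderiv ℝ (fun y => V y 0) (coneLift x) (Pi.single 2 1)
      + x 2 * fderiv ℝ (fun y => V y 0) (coneLift x) (Pi.single 3 1)
      = - V (coneLift x) 0 := by
    rw [← heuler]
    generalize fderiv ℝ (fun y => V y 0) (coneLift x) = A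
    simp only [hdec, map_add, map_smul, Complex.real_smul]
  have h0 : coneLift x 0 = ‖x‖ := rfl
  have h1 : coneLift x 1 = x 0 := rfl
  have h2 : coneLift x 2 = x 1 := rfl
  have h3 : coneLift x 3 = x 2 := rfl
  simp only [minkC, h0, h1, h2, h3] at htime horthx
  have s0 : (0 : Fin 3).succ = (1 : Fin 4) := rfl
  have s1 : (1 : Fin 3).succ = (2 : Fin 4) := rfl
  have s2 : (2 : Fin 3).succ = (3 : Fin 4) := rfl
  simp only [hderiv, Fin.sum_univ_three, Fin.sum_univ_four, divergence4, tangentField,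
    s0, s1, s2, Complex.ofReal_inv]
  generalize fderiv ℝ (fun y => V y 0) (coneLift x) = A0 at *
  generalize fderiv ℝ (fun y => V y 1) (coneLift x) = A1 at *
  generalize fderiv ℝ (fun y => V y 2) (coneLift x) = A2 at *
  generalize fderiv ℝ (fun y => V y 3) (coneLift x) = A3 at *
  generalize V (coneLift x) = W at *
  have hq : (‖x‖ : ℂ) * (‖x‖ : ℂ)⁻¹ = 1 := mul_inv_cancel₀ hr
  simp only [div_eq_mul_inv, ← inv_pow, one_mul]
  generalize (‖x‖ : ℂ)⁻¹ = q at *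
  have hS : ((x 0 : ℂ) ^ 2 + (x 1 : ℂ) ^ 2 + (x 2 : ℂ) ^ 2) * q ^ 2 = 1 := by
    rw [← hsq, ← mul_pow, hq, one_pow]
  generalize ((deriv η ‖x‖ : ℝ) : ℂ) = η'
  generalize ((η ‖x‖ : ℝ) : ℂ) = ηx
  linear_combination (-η' * q) * horthx + (η' * W 0 + 2 * ηx * A0 (Pi.single 0 1)) * hq
    + (-η' * W 0 + ηx * q * W 0 - ηx * A0 (Pi.single 0 1)) * hS
    - ηx * q * htime - ηx * q * heuler'

end Cutoff

/-- The integral of a directional derivative of a compactly supported function vanishes. -/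
lemma integral_fderiv_apply_eq_zero {E : Type*} [NormedAddCommGroup E] [NormedSpace ℝ E]
    [FiniteDimensional ℝ E] [MeasurableSpace E] [BorelSpace E] {μ : Measure E}
    [μ.IsAddHaarMeasure] {f : E → ℂ} (hf : ContDiff ℝ 1 f) (hc : HasCompactSupport f) (v : E) :
    Integrable (fun x => fderiv ℝ f x v) μ ∧ ∫ x, fderiv ℝ f x v ∂μ = 0 := by
  have hint : Integrable (fun x => fderiv ℝ f x v) μ :=
    ((hf.continuous_fderiv one_ne_zero).clm_apply continuous_const).integrable_of_hasCompactSupport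
      (hc.fderiv_apply ℝ v)
  refine ⟨hint, ?_⟩
  have h := integral_mul_fderiv_eq_neg_fderiv_mul_of_integrable (μ := μ) (𝕜 := ℂ)
    (f := fun _ => 1) (g := f) (v := v) (by simp) (by simpa using hint)
    (by simpa using hf.continuous.integrable_of_hasCompactSupport hc)
    (fun _ _ => differentiableAt_const _) (fun x _ => hf.differentiable one_ne_zero x)
  simpa using h

/-- Polar coordinates for a product of a radial and an angular function. -/
lemma integral_radial_mul_angular {E : Type*} [NormedAddCommGroup E] [NormedSpace ℝ E]
    [FiniteDimensional ℝ E] [Nontrivial E] [MeasurableSpace E] [BorelSpace E] (μ : Measure E)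
    [μ.IsAddHaarMeasure] (φ : ℝ → ℂ) (g : E → ℂ) :
    ∫ x, φ ‖x‖ * g (‖x‖⁻¹ • x) ∂μ
      = (∫ n : Metric.sphere (0 : E) 1, g n ∂μ.toSphere)
        * ∫ r : Set.Ioi (0 : ℝ), φ r ∂(Measure.volumeIoiPow (Module.finrank ℝ E - 1)) := by
  have h0 : ∫ x, φ ‖x‖ * g (‖x‖⁻¹ • x) ∂μ
      = ∫ x : ({0}ᶜ : Set E), φ ‖x.1‖ * g (‖x.1‖⁻¹ • x.1) ∂(μ.comap (↑)) := by
    rw [integral_subtype_comap (measurableSet_singleton _).compl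
      fun x => φ ‖x‖ * g (‖x‖⁻¹ • x), restrict_compl_singleton]
  rw [h0, ← integral_prod_mul, ← μ.measurePreserving_homeomorphUnitSphereProd.integral_comp
    (Homeomorph.measurableEmbedding _)]
  simp [mul_comm]

theorem integral_div_homogeneous_zero (U : Set (Fin 4 → ℝ)) (hUopen : IsOpen U)
    (hUcone : {l : Fin 4 → ℝ | mink4 l l = 0 ∧ 0 < l 0} ⊆ U)
    (hUscale : ∀ lam : ℝ, 0 < lam → ∀ l ∈ U, lam • l ∈ U)
    (V : (Fin 4 → ℝ) → (Fin 4 → ℂ)) (hV : ContDiffOn ℝ (⊤ : ℕ∞) V U)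
    (hhom : ∀ lam : ℝ, 0 < lam → ∀ l ∈ U, V (lam • l) = ((lam : ℂ)⁻¹) • V l)
    (horth : ∀ l ∈ U, minkC l (V l) = 0) :
    (∫ n : Metric.sphere (0 : EuclideanSpace ℝ (Fin 3)) 1,
        (∑ a : Fin 4, fderiv ℝ (fun y => V y a) (toCone n) (Pi.single a 1))
      ∂(volume : Measure (EuclideanSpace ℝ (Fin 3))).toSphere) = 0 := by
  let ψ : ContDiffBump (2 : ℝ) := ⟨1 / 2, 1, by norm_num, by norm_num⟩
  let η : ℝ → ℝ := fun r => r ^ 2 * ψ r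
  have hψ0 (r : ℝ) (hr : r ≤ 1) : ψ r = 0 :=
    ψ.zero_of_le_dist (by rw [Real.dist_eq, abs_of_nonpos] <;> simp [ψ] <;> linarith)
  have hψ3 (r : ℝ) (hr : 3 ≤ r) : ψ r = 0 :=
    ψ.zero_of_le_dist (by rw [Real.dist_eq, abs_of_nonneg] <;> simp [ψ] <;> linarith)
  have hη : ContDiff ℝ 1 η := (contDiff_id.pow 2).mul ψ.contDiff
  have hη0 (r : ℝ) (hr : r ≤ 1) : η r = 0 := by simp [η, hψ0 r hr]
  have hη3 (r : ℝ) (hr : 3 ≤ r) : η r = 0 := by simp [η, hψ3 r hr]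
  have hV1 : ContDiffOn ℝ 1 V U := hV.of_le (by exact_mod_cast le_top)
  have hsmooth (i : Fin 3) : ContDiff ℝ 1 (cutoffField η V i) :=
    contDiff_cutoffField hη hη0
      (fun x hx => hV1.contDiffAt (hUopen.mem_nhds (hUcone (coneLift_mem_cone hx)))) i
  have hzero (i : Fin 3) := integral_fderiv_apply_eq_zero
    (μ := (volume : Measure (EuclideanSpace ℝ (Fin 3)))) (hsmooth i)
    (hasCompactSupport_cutoffField hη3 i) (EuclideanSpace.single i 1)
  have hdiv : ∫ x : EuclideanSpace ℝ (Fin 3), (η ‖x‖ : ℂ) * divergence4 V (coneLift x) = 0 := by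
    simp_rw [← sum_fderiv_cutoffField hUopen hUcone (hV1.differentiableOn one_ne_zero) hhom
      horth (hη.differentiable one_ne_zero) hη0
      (fun i => (hsmooth i).differentiable one_ne_zero)]
    rw [integral_finsetSum _ fun i _ => (hzero i).1]
    exact Finset.sum_eq_zero fun i _ => (hzero i).2
  have hscale (x : EuclideanSpace ℝ (Fin 3)) : (η ‖x‖ : ℂ) * divergence4 V (coneLift x)
      = (ψ ‖x‖ : ℂ) * divergence4 V (coneLift (‖x‖⁻¹ • x)) := by
    by_cases hx : x = 0
    · simp [hx, hη0, hψ0]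
    have hr : 0 < ‖x‖ := norm_pos_iff.2 hx
    have hu : ‖x‖⁻¹ • x ≠ 0 := smul_ne_zero (inv_ne_zero hr.ne') hx
    have hterm (a : Fin 4) := fderiv_smul_of_homogeneous (F := fun y => V y a) hUopen
      (fun lam hlam l hl => by simp [hhom lam hlam l hl]) hr
      (hUcone (coneLift_mem_cone hu)) (Pi.single a 1)
    rw [← coneLift_smul hr.le, smul_inv_smul₀ hr.ne'] at hterm
    simp only [divergence4, ← hterm, ← Finset.mul_sum, η]
    push_cast
    ring
  simp_rw [hscale] at hdiv
  rw [integral_radial_mul_angular volume (fun r => (ψ r : ℂ))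
    (fun x => divergence4 V (coneLift x))] at hdiv
  have hpos : 0 < ∫ x : EuclideanSpace ℝ (Fin 3), ψ ‖x‖ := by
    refine Continuous.integral_pos_of_hasCompactSupport_nonneg_nonzero
      (x := EuclideanSpace.single 0 2) (ψ.continuous.comp continuous_norm) ?_
      (fun x => ψ.nonneg) ?_
    · refine HasCompactSupport.intro (isCompact_closedBall 0 3) fun x hx => ?_
      rw [mem_closedBall_zero_iff, not_le] at hx
      exact hψ3 _ hx.le
    · have h2 : ‖(EuclideanSpace.single 0 2 : EuclideanSpace ℝ (Fin 3))‖ = 2 := by simp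
      rw [h2]
      exact (ψ.pos_of_mem_ball (Metric.mem_ball_self ψ.rOut_pos)).ne'
  have hradial := integral_radial_mul_angular
    (volume : Measure (EuclideanSpace ℝ (Fin 3))) (fun r => (ψ r : ℂ)) (fun _ => 1)
  simp only [mul_one, integral_complex_ofReal] at hradial
  rcases mul_eq_zero.1 hdiv with h | h
  · rw [← h]
    refine integral_congr_ae (Filter.Eventually.of_forall fun n => ?_)
    simp only [divergence4]
    rw [coneLift_of_norm_eq_one (norm_eq_of_mem_sphere n)]
  · rw [integral_complex_ofReal] at h
    rw [h, mul_zero] at hradial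
    exact absurd (by exact_mod_cast hradial) hpos.ne'

end
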